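/- arXiv:1707.09918 — 3 statements merged into one kernel-verified Lean document; each statement's English description precedes it below -/
import Mathlib

section
/- The generating functions nrb_ee(x) and nrb_nn(x) counting EE-paths, respectively NN-paths, in L_{β/α}(k) having no right bounces satisfy nrb_ee(x)·(1 − f_en(x)) = f_ee(x), nrb_ee(x)·(1 + g_en(x)) = g_ee(x), nrb_nn(x)·(1 − f_en(x)) = f_nn(x), and nrb_nn(x)·(1 + g_en(x)) = g_nn(x). The same four identities hold for the generating functions counting EE-paths, respectively NN-paths, having no left bounces. -/
/-!
Lattice paths with unit East (`true`) and unit North (`false`) steps,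
bounces with respect to the line `y = (β/α)·x`, and the associated
generating functions over `ℚ`.
-/

/-- A lattice path is a list of unit steps: `true` = East, `false` = North. -/
abbrev LatticePath := List Bool

/-- `p` is a lattice path from `(0,0)` to `(α*k, β*k)`, i.e. a member of `L_{β/α}(k)`. -/
def InL (α β k : ℕ) (p : LatticePath) : Prop :=
  p.count true = α * k ∧ p.count false = β * k

/-- `p` has a left bounce at step index `i`: step `i` is an E-step, step `i+1` is an
N-step, and their common endpoint (the point reached after `i+1` steps) lies on the
line `y = (β/α)·x`, i.e. `α·y = β·x`. -/
def IsLeftBounce (α β : ℕ) (p : LatticePath) (i : ℕ) : Prop :=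
  p[i]? = some true ∧ p[i + 1]? = some false ∧
    α * ((p.take (i + 1)).count false) = β * ((p.take (i + 1)).count true)

/-- `p` has a right bounce at step index `i`: step `i` is an N-step, step `i+1` is an
E-step, and their common endpoint lies on the line `y = (β/α)·x`. -/
def IsRightBounce (α β : ℕ) (p : LatticePath) (i : ℕ) : Prop :=
  p[i]? = some false ∧ p[i + 1]? = some true ∧
    α * ((p.take (i + 1)).count false) = β * ((p.take (i + 1)).count true)

/-- The number of left bounces of `p` with respect to the line `y = (β/α)·x`. -/
noncomputable def leftBounces (α β : ℕ) (p : LatticePath) : ℕ :=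
  {i | IsLeftBounce α β p i}.ncard

/-- The number of right bounces of `p` with respect to the line `y = (β/α)·x`. -/
noncomputable def rightBounces (α β : ℕ) (p : LatticePath) : ℕ :=
  {i | IsRightBounce α β p i}.ncard

/-- `p` is bounce-free: it has no left and no right bounces. -/
def BounceFree (α β : ℕ) (p : LatticePath) : Prop :=
  (∀ i, ¬ IsLeftBounce α β p i) ∧ (∀ i, ¬ IsRightBounce α β p i)

/-- The first step of `p` is `a`. -/
def FirstStep (p : LatticePath) (a : Bool) : Prop := p.head? = some a

/-- The last step of `p` is `b`. -/
def LastStep (p : LatticePath) (b : Bool) : Prop := p.getLast? = some b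

/-- The generating function `Σ_{k≥1} |S k|·xᵏ ∈ ℚ[[x]]` of a family of path sets. -/
noncomputable def gfOf (S : ℕ → Set LatticePath) : PowerSeries ℚ :=
  PowerSeries.mk fun k => if k = 0 then 0 else ((S k).ncard : ℚ)

/-- `g(x) = Σ_{k≥1} C((α+β)k, αk)·xᵏ`, counting all paths in `L_{β/α}(k)`. -/
noncomputable def gSer (α β : ℕ) : PowerSeries ℚ :=
  PowerSeries.mk fun k => if k = 0 then 0 else ((((α + β) * k).choose (α * k) : ℕ) : ℚ)

/-- `g_ee(x) = Σ_{k≥1} C((α+β)k−2, αk−2)·xᵏ`, counting EE-paths in `L_{β/α}(k)`.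
We write the lower index as `βk = ((α+β)k−2) − (αk−2)`, which equals
`C((α+β)k−2, αk−2)` by the symmetry of binomial coefficients and correctly
implements the convention `C(n, −1) = 0` (needed when `αk = 1`), which ℕ-truncated
subtraction would not. -/
noncomputable def geeSer (α β : ℕ) : PowerSeries ℚ :=
  PowerSeries.mk fun k => if k = 0 then 0 else ((((α + β) * k - 2).choose (β * k) : ℕ) : ℚ)

/-- `g_en(x) = Σ_{k≥1} C((α+β)k−2, αk−1)·xᵏ`, counting EN-paths in `L_{β/α}(k)`. -/
noncomputable def genSer (α β : ℕ) : PowerSeries ℚ :=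
  PowerSeries.mk fun k => if k = 0 then 0 else ((((α + β) * k - 2).choose (α * k - 1) : ℕ) : ℚ)

/-- `g_nn(x) = Σ_{k≥1} C((α+β)k−2, αk)·xᵏ`, counting NN-paths in `L_{β/α}(k)`. -/
noncomputable def gnnSer (α β : ℕ) : PowerSeries ℚ :=
  PowerSeries.mk fun k => if k = 0 then 0 else ((((α + β) * k - 2).choose (α * k) : ℕ) : ℚ)

/-- `f_ee(x)`: generating function of bounce-free EE-paths in `L_{β/α}(k)`. -/
noncomputable def feeSer (α β : ℕ) : PowerSeries ℚ :=
  gfOf fun k => {p | InL α β k p ∧ BounceFree α β p ∧ FirstStep p true ∧ LastStep p true}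

/-- `f_en(x)`: generating function of bounce-free EN-paths in `L_{β/α}(k)`. -/
noncomputable def fenSer (α β : ℕ) : PowerSeries ℚ :=
  gfOf fun k => {p | InL α β k p ∧ BounceFree α β p ∧ FirstStep p true ∧ LastStep p false}

/-- `f_nn(x)`: generating function of bounce-free NN-paths in `L_{β/α}(k)`. -/
noncomputable def fnnSer (α β : ℕ) : PowerSeries ℚ :=
  gfOf fun k => {p | InL α β k p ∧ BounceFree α β p ∧ FirstStep p false ∧ LastStep p false}

/-- `f(x)`: generating function of all bounce-free paths in `L_{β/α}(k)`. -/
noncomputable def fSer (α β : ℕ) : PowerSeries ℚ :=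
  gfOf fun k => {p | InL α β k p ∧ BounceFree α β p}

/-- `B_{ℓ,r}(x)`: generating function of paths in `L_{β/α}(k)` with exactly `ℓ`
left bounces and exactly `r` right bounces. -/
noncomputable def BSer (α β ℓ r : ℕ) : PowerSeries ℚ :=
  gfOf fun k => {p | InL α β k p ∧ leftBounces α β p = ℓ ∧ rightBounces α β p = r}

/-- The Fuss–Catalan generating function `c_α(x) = Σ_{k≥0} 1/(αk+1)·C((α+1)k, k)·xᵏ`. -/
noncomputable def fussCatalan (α : ℕ) : PowerSeries ℚ :=
  PowerSeries.mk fun k => (1 / ((α * k + 1 : ℕ) : ℚ)) * ((((α + 1) * k).choose k : ℕ) : ℚ)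

/-- For slope `1/α`: `p` has a horizontal cross at the lattice point `(α*i, i)` (`i ≥ 1`):
`p` passes through `(α*i, i)` (so the prefix of length `(α+1)*i` has exactly `α*i`
E-steps), and both the step ending there and the step starting there are E-steps. -/
def HasHCrossAt (α : ℕ) (p : LatticePath) (i : ℕ) : Prop :=
  1 ≤ i ∧ (p.take ((α + 1) * i)).count true = α * i ∧
    p[(α + 1) * i - 1]? = some true ∧ p[(α + 1) * i]? = some true

/-- `p` has no horizontal crosses with respect to the line `y = x/α`. -/
def NoHCross (α : ℕ) (p : LatticePath) : Prop := ∀ i, ¬ HasHCrossAt α p i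

/-- Generating function of EE-paths in `L_{β/α}(k)` with no right bounces. -/
noncomputable def nrbEE (α β : ℕ) : PowerSeries ℚ :=
  gfOf fun k => {p | InL α β k p ∧ (∀ i, ¬ IsRightBounce α β p i) ∧
    FirstStep p true ∧ LastStep p true}

/-- Generating function of NN-paths in `L_{β/α}(k)` with no right bounces. -/
noncomputable def nrbNN (α β : ℕ) : PowerSeries ℚ :=
  gfOf fun k => {p | InL α β k p ∧ (∀ i, ¬ IsRightBounce α β p i) ∧
    FirstStep p false ∧ LastStep p false}

/-- Generating function of EE-paths in `L_{β/α}(k)` with no left bounces. -/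
noncomputable def nlbEE (α β : ℕ) : PowerSeries ℚ :=
  gfOf fun k => {p | InL α β k p ∧ (∀ i, ¬ IsLeftBounce α β p i) ∧
    FirstStep p true ∧ LastStep p true}

/-- Generating function of NN-paths in `L_{β/α}(k)` with no left bounces. -/
noncomputable def nlbNN (α β : ℕ) : PowerSeries ℚ :=
  gfOf fun k => {p | InL α β k p ∧ (∀ i, ¬ IsLeftBounce α β p i) ∧
    FirstStep p false ∧ LastStep p false}


namespace LP

/-- bounce of type `d` : step `d` followed by the opposite step, at a point of the line -/
def B (α β : ℕ) (d : Bool) (p : LatticePath) (i : ℕ) : Prop :=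
  p[i]? = some d ∧ p[i + 1]? = some (!d) ∧
    α * ((p.take (i + 1)).count false) = β * ((p.take (i + 1)).count true)

def On (α β : ℕ) (p : LatticePath) : Prop := α * p.count false = β * p.count true

def Cls (α β : ℕ) (a b : Bool) (S : Bool → Prop) (k : ℕ) : Set LatticePath :=
  {p | InL α β k p ∧ (∀ d, S d → ∀ i, ¬ B α β d p i) ∧ FirstStep p a ∧ LastStep p b}

noncomputable def G (α β : ℕ) (a b : Bool) (S : Bool → Prop) : PowerSeries ℚ :=
  PowerSeries.mk fun k => ((Cls α β a b S k).ncard : ℚ)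

theorem _root_.InL.on {α β k : ℕ} {p : LatticePath} (h : InL α β k p) : On α β p := by
  unfold On; rw [h.1, h.2]; ring

theorem len_eq (p : LatticePath) : p.length = p.count true + p.count false := by
  induction p with
  | nil => rfl
  | cons x p ih => rw [List.length_cons, ih]; cases x <;> simp <;> omega

theorem InL_finite (α β k : ℕ) : {p | InL α β k p}.Finite := by
  refine (List.finite_length_eq Bool (α * k + β * k)).subset ?_
  intro p hp
  have := len_eq p
  rw [hp.1, hp.2] at this
  exact this

theorem Cls_finite (α β : ℕ) (a b : Bool) (S : Bool → Prop) (k : ℕ) :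
    (Cls α β a b S k).Finite := (InL_finite α β k).subset fun _ h => h.1

theorem Cls_zero (α β : ℕ) (a b : Bool) (S : Bool → Prop) : Cls α β a b S 0 = ∅ := by
  ext p
  simp only [Set.mem_empty_iff_false, iff_false]
  rintro ⟨⟨h1, h2⟩, -, h3, -⟩
  have := len_eq p
  rw [h1, h2] at this
  have : p = [] := List.eq_nil_of_length_eq_zero (by simpa using this)
  subst this
  simp [FirstStep] at h3

theorem gfOf_eq (α β : ℕ) (a b : Bool) (S : Bool → Prop) (T : ℕ → Set LatticePath)
    (h : ∀ k, T k = Cls α β a b S k) : gfOf T = G α β a b S := by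
  ext k
  simp only [gfOf, G, PowerSeries.coeff_mk]
  split_ifs with hk
  · subst hk; simp [Cls_zero]
  · rw [h]

theorem ser_eq (α β : ℕ) (a b : Bool) (f : ℕ → ℕ)
    (h : ∀ k, 0 < k → (Cls α β a b (fun _ => False) k).ncard = f k) :
    PowerSeries.mk (fun k => if k = 0 then (0:ℚ) else ((f k : ℕ) : ℚ)) =
      G α β a b (fun _ => False) := by
  ext k
  simp only [G, PowerSeries.coeff_mk]
  split_ifs with hk
  · subst hk; simp [Cls_zero]
  · rw [h k (Nat.pos_of_ne_zero hk)]

/-! ### reversal -/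

theorem B_reverse {α β : ℕ} {d : Bool} {p : LatticePath} (hp : On α β p) {i : ℕ}
    (h : B α β d p.reverse i) : ∃ j, B α β (!d) p j := by
  obtain ⟨h1, h2, h3⟩ := h
  have hl : i + 1 < p.reverse.length := (List.getElem?_eq_some_iff.1 h2).1
  rw [List.length_reverse] at hl
  rw [List.getElem?_reverse (by omega)] at h1 h2
  refine ⟨p.length - 1 - (i + 1), h2, ?_, ?_⟩
  · rw [Bool.not_not, ← h1]; congr 1; omega
  · rw [List.take_reverse, List.count_reverse, List.count_reverse] at h3
    have e : p.length - 1 - (i + 1) + 1 = p.length - (i + 1) := by omega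
    rw [e]
    unfold On at hp
    rw [← List.take_append_drop (p.length - (i + 1)) p] at hp
    rw [List.count_append, List.count_append, mul_add, mul_add] at hp
    omega

theorem Cls_reverse_mem {α β : ℕ} {a b : Bool} {S : Bool → Prop} {k : ℕ} {p : LatticePath}
    (h : p ∈ Cls α β a b S k) : p.reverse ∈ Cls α β b a (fun d => S (!d)) k := by
  obtain ⟨h1, h2, h3, h4⟩ := h
  refine ⟨⟨by simpa using h1.1, by simpa using h1.2⟩, ?_, ?_, ?_⟩
  · intro d hd i hB
    obtain ⟨j, hj⟩ := B_reverse h1.on hB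
    exact h2 _ hd j hj
  · simpa [FirstStep, LastStep] using h4
  · simpa [FirstStep, LastStep] using h3

theorem G_reverse (α β : ℕ) (a b : Bool) (S : Bool → Prop) :
    G α β a b S = G α β b a (fun d => S (!d)) := by
  ext k
  simp only [G, PowerSeries.coeff_mk]
  norm_cast
  rw [← Set.ncard_image_of_injective (Cls α β a b S k) List.reverse_injective]
  congr 1
  ext p
  constructor
  · rintro ⟨q, hq, rfl⟩; exact Cls_reverse_mem hq
  · intro hp
    refine ⟨p.reverse, ?_, by simp⟩
    simpa using Cls_reverse_mem hp

/-! ### decomposition -/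

theorem B_append_left {α β : ℕ} {d : Bool} {p q : LatticePath} {m : ℕ}
    (h : m + 1 < p.length) : B α β d (p ++ q) m ↔ B α β d p m := by
  unfold B
  rw [List.getElem?_append_left (by omega), List.getElem?_append_left h,
    List.take_append_of_le_length (by omega)]

theorem B_append_right {α β : ℕ} {d : Bool} {p q : LatticePath} {m : ℕ} (hp : On α β p) :
    B α β d (p ++ q) (p.length + m) ↔ B α β d q m := by
  unfold B
  rw [List.getElem?_append_right (by omega), List.getElem?_append_right (by omega),
    add_assoc, List.take_length_add_append, List.count_append, List.count_append,
    mul_add, mul_add, hp]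
  simp only [Nat.add_sub_cancel_left, add_right_inj]

theorem B_lt {α β : ℕ} {d : Bool} {p : LatticePath} {m : ℕ} (h : B α β d p m) :
    m + 1 < p.length := (List.getElem?_eq_some_iff.1 h.2.1).1

theorem B_append_mid {α β : ℕ} {d : Bool} {p q : LatticePath} {m : ℕ} (hp : On α β p)
    (h : m + 1 = p.length) : B α β d (p ++ q) m ↔ LastStep p d ∧ FirstStep q (!d) := by
  unfold B LastStep FirstStep
  rw [List.getElem?_append_left (by omega), List.getElem?_append_right (by omega),
    h, List.take_left, List.getLast?_eq_getElem?, List.head?_eq_getElem?]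
  have : m = p.length - 1 := by omega
  subst this
  simp only [Nat.sub_self]
  unfold On at hp
  tauto

theorem On.exists {α β : ℕ} (hα : 0 < α) (hcop : Nat.Coprime α β)
    {p : LatticePath} (h : On α β p) : ∃ i, InL α β i p := by
  unfold On at h
  have h1 : α ∣ p.count true := hcop.dvd_of_dvd_mul_left ⟨_, h.symm⟩
  obtain ⟨i, hi⟩ := h1
  refine ⟨i, hi, ?_⟩
  rw [hi] at h
  exact Nat.eq_of_mul_eq_mul_left hα (by rw [h]; ring)

theorem LastStep.ne_nil {p : LatticePath} {b : Bool} (h : LastStep p b) : p.length ≠ 0 := by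
  intro h0
  have := List.eq_nil_of_length_eq_zero h0
  subst this
  simp [LastStep] at h

theorem FirstStep.ne_nil {p : LatticePath} {b : Bool} (h : FirstStep p b) : p.length ≠ 0 := by
  intro h0
  have := List.eq_nil_of_length_eq_zero h0
  subst this
  simp [FirstStep] at h

theorem append_inj_aux {α β : ℕ} {c : Bool} {p q p' q' : LatticePath}
    (hp : On α β p) (hl : LastStep p c) (hq : FirstStep q (!c))
    (hp' : ∀ i, ¬ B α β c p' i) (h : p ++ q = p' ++ q') : p'.length ≤ p.length := by
  by_contra hlt
  push Not at hlt
  have h0 := LastStep.ne_nil hl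
  have hB : B α β c (p ++ q) (p.length - 1) := (B_append_mid hp (by omega)).2 ⟨hl, hq⟩
  rw [h, B_append_left (by omega)] at hB
  exact hp' _ hB

theorem append_mem {α β : ℕ} {a b c : Bool} {S : Bool → Prop} (hc : ¬ S c) {i j k : ℕ}
    (hk : i + j = k) {p q : LatticePath} (hp : p ∈ Cls α β a c (fun d => S d ∨ d = c) i)
    (hq : q ∈ Cls α β (!c) b S j) : p ++ q ∈ Cls α β a b S k := by
  obtain ⟨hp1, hp2, hp3, hp4⟩ := hp
  obtain ⟨hq1, hq2, hq3, hq4⟩ := hq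
  refine ⟨⟨?_, ?_⟩, ?_, ?_, ?_⟩
  · rw [List.count_append, hp1.1, hq1.1, ← hk]; ring
  · rw [List.count_append, hp1.2, hq1.2, ← hk]; ring
  · intro d hd m hB
    rcases lt_trichotomy (m + 1) p.length with h | h | h
    · rw [B_append_left h] at hB
      exact hp2 d (Or.inl hd) m hB
    · rw [B_append_mid hp1.on h] at hB
      have := hB.1
      unfold LastStep at this hp4
      rw [hp4] at this
      cases this
      exact hc hd
    · obtain ⟨n, rfl⟩ := Nat.exists_eq_add_of_le (show p.length ≤ m by omega)
      rw [B_append_right hp1.on] at hB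
      exact hq2 d hd n hB
  · unfold FirstStep at *
    rw [List.head?_append, hp3]; rfl
  · unfold LastStep at *
    rw [List.getLast?_append, hq4]; rfl

theorem split_mem {α β : ℕ} (hα : 0 < α) (hcop : Nat.Coprime α β)
    {a b c : Bool} {S : Bool → Prop} {k : ℕ} {r : LatticePath}
    (hr : r ∈ Cls α β a b S k) (hB : ∃ i, B α β c r i) :
    ∃ i j p q, i + j = k ∧ p ∈ Cls α β a c (fun d => S d ∨ d = c) i ∧
      q ∈ Cls α β (!c) b S j ∧ p ++ q = r := by
  classical
  obtain ⟨hr1, hr2, hr3, hr4⟩ := hr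
  let n := Nat.find hB
  have hn : B α β c r n := Nat.find_spec hB
  have hmin : ∀ m < n, ¬ B α β c r m := fun m hm => Nat.find_min hB hm
  have hlen := B_lt hn
  obtain ⟨p, q, hpq, hpl⟩ : ∃ p q, p ++ q = r ∧ p.length = n + 1 :=
    ⟨r.take (n+1), r.drop (n+1), List.take_append_drop _ _, by simp; omega⟩
  have hon : On α β p := by
    have h3 := hn.2.2
    rw [← hpq, ← hpl, List.take_left] at h3
    exact h3
  obtain ⟨i, hi⟩ := On.exists hα hcop hon
  subst hpq
  have hmid := (B_append_mid hon hpl.symm).1 hn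
  have hkc : i ≤ k := by
    have := hr1.1
    rw [List.count_append, hi.1] at this
    exact Nat.le_of_mul_le_mul_left (by omega) hα
  obtain ⟨j, rfl⟩ := Nat.exists_eq_add_of_le hkc
  refine ⟨i, j, p, q, rfl, ⟨hi, ?_, ?_, hmid.1⟩, ⟨⟨?_, ?_⟩, ?_, hmid.2, ?_⟩, rfl⟩
  · rintro d hd m hm
    have hlt := B_lt hm
    have hm' := (B_append_left (q := q) hlt).2 hm
    rcases hd with hd | rfl
    · exact hr2 d hd m hm'
    · exact hmin m (by omega) hm'
  · unfold FirstStep at *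
    cases p with
    | nil => simp at hpl
    | cons x p => simpa using hr3
  · have := hr1.1
    rw [List.count_append, hi.1, mul_add] at this
    omega
  · have := hr1.2
    rw [List.count_append, hi.2, mul_add] at this
    omega
  · intro d hd m hm
    exact hr2 d hd _ ((B_append_right hon).2 hm)
  · have hq := FirstStep.ne_nil hmid.2
    unfold LastStep at *
    rcases List.eq_nil_or_concat q with rfl | ⟨q', x, rfl⟩
    · simp at hq
    · rw [← hr4]; simp

theorem decomp {α β : ℕ} (hα : 0 < α) (hcop : Nat.Coprime α β)
    (a b c : Bool) (S : Bool → Prop) (hc : ¬ S c) :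
    G α β a b S = G α β a b (fun d => S d ∨ d = c) +
      G α β a c (fun d => S d ∨ d = c) * G α β (!c) b S := by
  classical
  ext k
  rw [map_add, PowerSeries.coeff_mul]
  simp only [G, PowerSeries.coeff_mk]
  norm_cast
  simp only [Set.ncard_eq_toFinset_card _ (Cls_finite _ _ _ _ _ _)]
  rw [← Finset.card_filter_add_card_filter_not (s := (Cls_finite α β a b S k).toFinset)
    (fun p => ∀ i, ¬ B α β c p i)]
  congr 1
  · congr 1
    ext p
    simp only [Finset.mem_filter, Set.Finite.mem_toFinset, Cls, Set.mem_ofPred_eq]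
    constructor
    · rintro ⟨⟨h1, h2, h3⟩, h4⟩
      refine ⟨h1, ?_, h3⟩
      rintro d (hd | rfl)
      · exact h2 d hd
      · exact h4
    · rintro ⟨h1, h2, h3⟩
      exact ⟨⟨h1, fun d hd => h2 d (Or.inl hd), h3⟩, h2 c (Or.inr rfl)⟩
  · simp only [← Finset.card_product]
    rw [← Finset.card_sigma]
    symm
    refine Finset.card_bij (fun x _ => x.2.1 ++ x.2.2) ?_ ?_ ?_
    · rintro ⟨⟨i, j⟩, p, q⟩ h
      simp only [Finset.mem_sigma, Finset.mem_product,
        Set.Finite.mem_toFinset] at h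
      obtain ⟨hk, hp, hq⟩ := h
      replace hk := Finset.HasAntidiagonal.mem_antidiagonal.1 hk
      simp only [Finset.mem_filter, Set.Finite.mem_toFinset]
      refine ⟨append_mem hc hk hp hq, fun hno => ?_⟩
      have h0 := LastStep.ne_nil hp.2.2.2
      exact hno (p.length - 1)
        ((B_append_mid hp.1.on (by omega)).2 ⟨hp.2.2.2, hq.2.2.1⟩)
    · rintro ⟨⟨i, j⟩, p, q⟩ h ⟨⟨i', j'⟩, p', q'⟩ h' heq
      simp only [Finset.mem_sigma, Finset.mem_product,
        Set.Finite.mem_toFinset] at h h' heq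
      obtain ⟨hk, hp, hq⟩ := h
      replace hk := Finset.HasAntidiagonal.mem_antidiagonal.1 hk
      obtain ⟨hk', hp', hq'⟩ := h'
      replace hk' := Finset.HasAntidiagonal.mem_antidiagonal.1 hk'
      dsimp only at hk hk'
      have l1 := append_inj_aux hp.1.on hp.2.2.2 hq.2.2.1 (hp'.2.1 c (Or.inr rfl)) heq
      have l2 := append_inj_aux hp'.1.on hp'.2.2.2 hq'.2.2.1 (hp.2.1 c (Or.inr rfl)) heq.symm
      obtain ⟨rfl, rfl⟩ := List.append_inj heq (le_antisymm l2 l1)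
      have : i = i' := Nat.eq_of_mul_eq_mul_left hα (hp.1.1.symm.trans hp'.1.1)
      subst this
      have : j = j' := by omega
      subst this
      rfl
    · intro r hr
      simp only [Finset.mem_filter, Set.Finite.mem_toFinset, not_forall, not_not] at hr
      obtain ⟨i, j, p, q, hk, hp, hq, e⟩ := split_mem hα hcop hr.1 hr.2
      refine ⟨⟨(i, j), (p, q)⟩, ?_, e⟩
      simp only [Finset.mem_sigma, Finset.mem_product,
        Set.Finite.mem_toFinset]
      exact ⟨Finset.HasAntidiagonal.mem_antidiagonal.2 hk, hp, hq⟩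

/-! ### binomials -/

theorem W_finite (n t : ℕ) (d : Bool) :
    {m : List Bool | m.length = n ∧ m.count d = t}.Finite :=
  (List.finite_length_eq Bool n).subset fun _ h => h.1

theorem W_card (d : Bool) (n : ℕ) : ∀ t : ℕ,
    {m : List Bool | m.length = n ∧ m.count d = t}.ncard = n.choose t := by
  induction n with
  | zero =>
    intro t
    cases t with
    | zero =>
      have : {m : List Bool | m.length = 0 ∧ m.count d = 0} = {[]} := by
        ext m; cases m <;> simp
      rw [this]; simp
    | succ t =>
      have : {m : List Bool | m.length = 0 ∧ m.count d = t + 1} = ∅ := by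
        ext m; cases m <;> simp
      rw [this]; simp
  | succ n ih =>
    intro t
    have hinj : ∀ x : Bool, Function.Injective (fun m : List Bool => x :: m) :=
      fun x => List.cons_injective
    cases t with
    | zero =>
      have : {m : List Bool | m.length = n + 1 ∧ m.count d = 0} =
          (fun m => (!d) :: m) '' {m : List Bool | m.length = n ∧ m.count d = 0} := by
        ext m
        cases m with
        | nil => simp
        | cons x m => cases d <;> cases x <;> simp
      rw [this, Set.ncard_image_of_injective _ (hinj _), ih]; simp
    | succ t =>
      have : {m : List Bool | m.length = n + 1 ∧ m.count d = t + 1} =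
          (fun m => d :: m) '' {m : List Bool | m.length = n ∧ m.count d = t} ∪
          (fun m => (!d) :: m) '' {m : List Bool | m.length = n ∧ m.count d = t + 1} := by
        ext m
        cases m with
        | nil => simp
        | cons x m => cases d <;> cases x <;> simp
      rw [this, Set.ncard_union_eq _ ((W_finite _ _ _).image _) ((W_finite _ _ _).image _),
        Set.ncard_image_of_injective _ (hinj _), Set.ncard_image_of_injective _ (hinj _),
        ih, ih, Nat.choose_succ_succ]
      rw [Set.disjoint_left]
      rintro _ ⟨m, -, rfl⟩ ⟨m', -, h⟩
      cases d <;> simp at h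

theorem Cls_card {α β : ℕ} (hα : 0 < α) (hβ : 0 < β) (a b d : Bool) (k t : ℕ) (hk : 0 < k)
    (ht : t + [a, b].count d = (if d then α * k else β * k)) :
    (Cls α β a b (fun _ => False) k).ncard = ((α + β) * k - 2).choose t := by
  rw [← W_card d]
  have hak : 0 < α * k := Nat.mul_pos hα hk
  have hbk : 0 < β * k := Nat.mul_pos hβ hk
  have hinj : Function.Injective (fun m : List Bool => a :: (m ++ [b])) := by
    intro m m' h; simpa using h
  rw [← Set.ncard_image_of_injective {m : List Bool | _} hinj]
  congr 1
  ext p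
  have hlen := len_eq p
  constructor
  · rintro ⟨⟨h1, h2⟩, -, h3, h4⟩
    cases p with
    | nil => simp [FirstStep] at h3
    | cons x p =>
      rcases List.eq_nil_or_concat p with rfl | ⟨m, y, rfl⟩
      · simp at hlen h1 h2; cases x <;> simp at * <;> omega
      · rw [List.concat_eq_append] at *
        simp only [FirstStep, List.head?_cons, Option.some.injEq] at h3
        have h4' : y = b := by
          unfold LastStep at h4
          rw [← List.cons_append, List.getLast?_concat] at h4
          simpa using h4
        subst h3 h4'
        refine ⟨m, ⟨?_, ?_⟩, by simp⟩
        · rw [h1, h2] at hlen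
          simp at hlen
          rw [add_mul]; omega
        · cases d <;> simp [List.count_cons, List.count_append] at ht h1 h2 ⊢ <;> omega
  · rintro ⟨m, ⟨h1, h2⟩, rfl⟩
    have hlm := len_eq m
    rw [add_mul] at h1
    refine ⟨?_, fun _ h => h.elim, ?_, ?_⟩
    · unfold InL
      cases d <;> cases a <;> cases b <;>
        simp [List.count_append] at ht h2 ⊢ <;> omega
    · simp [FirstStep]
    · unfold LastStep
      show (a :: (m ++ [b])).getLast? = some b
      rw [← List.cons_append, List.getLast?_concat]

theorem geeSer_eq {α β : ℕ} (hα : 0 < α) (hβ : 0 < β) :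
    geeSer α β = G α β true true (fun _ => False) :=
  ser_eq α β true true _ fun k hk => Cls_card hα hβ true true false k _ hk (by simp)

theorem gnnSer_eq {α β : ℕ} (hα : 0 < α) (hβ : 0 < β) :
    gnnSer α β = G α β false false (fun _ => False) :=
  ser_eq α β false false _ fun k hk => Cls_card hα hβ false false true k _ hk (by simp)

theorem genSer_eq {α β : ℕ} (hα : 0 < α) (hβ : 0 < β) :
    genSer α β = G α β true false (fun _ => False) :=
  ser_eq α β true false _ fun k hk => Cls_card hα hβ true false true k _ hk (by
    have hak : 0 < α * k := Nat.mul_pos hα hk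
    simp; omega)

theorem G_congr {α β : ℕ} {a b : Bool} {S T : Bool → Prop} (h : ∀ d, S d ↔ T d) :
    G α β a b S = G α β a b T := by
  have : S = T := funext fun d => propext (h d)
  rw [this]

theorem main {α β : ℕ} (hα : 0 < α) (hcop : Nat.Coprime α β) (c : Bool) :
    -- split paths at the first bounce of type `c`
    (∀ a, G α β a a (fun d => d = !c) =
      G α β a a (fun _ => True) + G α β a c (fun _ => True) * G α β (!c) a (fun d => d = !c)) ∧
    (∀ a, G α β a a (fun _ => False) =
      G α β a a (fun d => d = c) + G α β a c (fun d => d = c) * G α β (!c) a (fun _ => False)) := by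
  constructor
  · intro a
    have := decomp hα hcop a a c (fun d => d = !c) (by simp)
    rwa [G_congr (S := fun d => d = !c ∨ d = c) (T := fun _ => True) (by cases c <;> simp),
      G_congr (a := a) (b := c) (S := fun d => d = !c ∨ d = c) (T := fun _ => True) (by cases c <;> simp)] at this
  · intro a
    have := decomp hα hcop a a c (fun _ => False) (by simp)
    rwa [G_congr (S := fun d => False ∨ d = c) (T := fun d => d = c) (by simp),
      G_congr (a := a) (b := c) (S := fun d => False ∨ d = c) (T := fun d => d = c)
        (by simp)] at this

theorem f_eq (α β : ℕ) (a b : Bool) :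
    (gfOf fun k => {p | InL α β k p ∧ BounceFree α β p ∧ FirstStep p a ∧ LastStep p b}) =
      G α β a b (fun _ => True) := by
  refine gfOf_eq α β a b _ _ fun k => ?_
  ext p
  have : BounceFree α β p ↔ ∀ d, True → ∀ i, ¬ B α β d p i := by
    constructor
    · rintro ⟨h1, h2⟩ (_ | _) -
      · exact h2
      · exact h1
    · intro h
      exact ⟨h true trivial, h false trivial⟩
  simp only [Cls, Set.mem_ofPred_eq, this]

theorem nb_eq (α β : ℕ) (a b c : Bool) :
    (gfOf fun k => {p | InL α β k p ∧ (∀ i, ¬ B α β c p i) ∧ FirstStep p a ∧ LastStep p b}) =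
      G α β a b (fun d => d = c) := by
  refine gfOf_eq α β a b _ _ fun k => ?_
  ext p
  simp [Cls]

end LP

open LP

/-- `nrb_ee·(1 − f_en) = f_ee`, `nrb_ee·(1 + g_en) = g_ee`,
`nrb_nn·(1 − f_en) = f_nn`, `nrb_nn·(1 + g_en) = g_nn`, and the same four identities
for the no-left-bounce generating functions. -/
theorem statement2 (α β : ℕ) (hα : 0 < α) (hβ : 0 < β) (hcop : Nat.Coprime α β) :
    nrbEE α β * (1 - fenSer α β) = feeSer α β ∧
    nrbEE α β * (1 + genSer α β) = geeSer α β ∧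
    nrbNN α β * (1 - fenSer α β) = fnnSer α β ∧
    nrbNN α β * (1 + genSer α β) = gnnSer α β ∧
    nlbEE α β * (1 - fenSer α β) = feeSer α β ∧
    nlbEE α β * (1 + genSer α β) = geeSer α β ∧
    nlbNN α β * (1 - fenSer α β) = fnnSer α β ∧
    nlbNN α β * (1 + genSer α β) = gnnSer α β := by
  have hfee : feeSer α β = G α β true true (fun _ => True) := f_eq α β true true
  have hfen : fenSer α β = G α β true false (fun _ => True) := f_eq α β true false
  have hfnn : fnnSer α β = G α β false false (fun _ => True) := f_eq α β false false
  have hre : nrbEE α β = G α β true true (fun d => d = false) := nb_eq α β true true false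
  have hrn : nrbNN α β = G α β false false (fun d => d = false) := nb_eq α β false false false
  have hle : nlbEE α β = G α β true true (fun d => d = true) := nb_eq α β true true true
  have hln : nlbNN α β = G α β false false (fun d => d = true) := nb_eq α β false false true
  have hrle : G α β true true (fun d => d = false) = G α β true true (fun d => d = true) := by
    rw [G_reverse]; exact G_congr (by simp)
  have hrln : G α β false false (fun d => d = false) =
      G α β false false (fun d => d = true) := by
    rw [G_reverse]; exact G_congr (by simp)
  have hf : G α β false true (fun _ => True) = G α β true false (fun _ => True) :=
    G_reverse _ _ _ _ _
  have hg : G α β false true (fun _ => False) = G α β true false (fun _ => False) :=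
    G_reverse _ _ _ _ _
  obtain ⟨t1, t2⟩ := main hα hcop true
  obtain ⟨f1, f2⟩ := main hα hcop false
  have e5 := f1 true
  have e6 := t2 true
  have e3 := t1 false
  have e4 := f2 false
  simp only [Bool.not_true, Bool.not_false] at e3 e4 e5 e6
  rw [hf] at e3
  rw [hg] at e6
  rw [hfee, hfen, hfnn, hre, hrn, hle, hln, geeSer_eq hα hβ, genSer_eq hα hβ, gnnSer_eq hα hβ,
    hrle]
  rw [hrln] at e3 e4 ⊢
  have r5 : G α β true true (fun d => d = true) * (1 - G α β true false (fun _ => True)) =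
      G α β true true (fun _ => True) := by linear_combination e5
  have r6 : G α β true true (fun d => d = true) * (1 + G α β true false (fun _ => False)) =
      G α β true true (fun _ => False) := by linear_combination -e6
  have r3 : G α β false false (fun d => d = true) * (1 - G α β true false (fun _ => True)) =
      G α β false false (fun _ => True) := by linear_combination e3
  have r4 : G α β false false (fun d => d = true) * (1 + G α β true false (fun _ => False)) =
      G α β false false (fun _ => False) := by linear_combination -e4
  exact ⟨r5, r6, r3, r4, r5, r6, r3, r4⟩
end

section
/- The generating function counting paths in L_{β/α}(k) with no right bounces equals the generating function counting paths in L_{β/α}(k) with no left bounces, and both satisfy nrb(x)·(1 + g_en(x)) = g(x) + g_en(x)² − g_ee(x)·g_nn(x). -/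
/-- Generating function of paths in `L_{β/α}(k)` with no right bounces. -/
noncomputable def nrbAll (α β : ℕ) : PowerSeries ℚ :=
  gfOf fun k => {p | InL α β k p ∧ ∀ i, ¬ IsRightBounce α β p i}

/-- Generating function of paths in `L_{β/α}(k)` with no left bounces. -/
noncomputable def nlbAll (α β : ℕ) : PowerSeries ℚ :=
  gfOf fun k => {p | InL α β k p ∧ ∀ i, ¬ IsLeftBounce α β p i}

/-- Lists with `a` East steps and `b` North steps. -/
def WSet (a b : ℕ) : Set LatticePath := {p | p.count true = a ∧ p.count false = b}

theorem WSet_finite (a b : ℕ) : (WSet a b).Finite := by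
  refine (List.finite_length_eq Bool (a + b)).subset ?_
  rintro p ⟨h1, h2⟩
  have := List.count_true_add_count_false p
  simp only [Set.mem_ofPred_eq]
  omega

theorem WSet_ncard_aux (n : ℕ) : ∀ a b : ℕ, a + b = n → (WSet a b).ncard = (a + b).choose a := by
  induction n with
  | zero =>
    intro a b h
    obtain ⟨rfl, rfl⟩ : a = 0 ∧ b = 0 := by omega
    have : WSet 0 0 = {[]} := by
      ext p
      rcases p with _ | ⟨c, p⟩
      · simp [WSet]
      · cases c <;> simp [WSet]
    simp [this]
  | succ n ih =>
    intro a b h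
    have hinj : ∀ c : Bool, Function.Injective (List.cons c) := fun c => List.cons_injective
    rcases a with _ | a
    · rcases b with _ | b
      · omega
      have : WSet 0 (b + 1) = List.cons false '' WSet 0 b := by
        ext p
        rcases p with _ | ⟨c, p⟩
        · simp [WSet]
        · cases c <;> simp [WSet]
      rw [this, Set.ncard_image_of_injective _ (hinj _), ih _ _ (by omega)]
      simp
    · rcases b with _ | b
      · have : WSet (a + 1) 0 = List.cons true '' WSet a 0 := by
          ext p
          rcases p with _ | ⟨c, p⟩
          · simp [WSet]
          · cases c <;> simp [WSet]
        rw [this, Set.ncard_image_of_injective _ (hinj _), ih _ _ (by omega)]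
        simp
      · have : WSet (a + 1) (b + 1) =
            List.cons true '' WSet a (b + 1) ∪ List.cons false '' WSet (a + 1) b := by
          ext p
          rcases p with _ | ⟨c, p⟩
          · simp [WSet]
          · cases c <;> simp [WSet]
        rw [this, Set.ncard_union_eq ?_ ((WSet_finite _ _).image _) ((WSet_finite _ _).image _),
          Set.ncard_image_of_injective _ (hinj _), Set.ncard_image_of_injective _ (hinj _),
          ih _ _ (by omega), ih _ _ (by omega)]
        · rw [show a + 1 + (b + 1) = (a + b + 1) + 1 by ring, Nat.choose_succ_succ,
            show a + (b + 1) = a + b + 1 by ring, show a + 1 + b = a + b + 1 by ring]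
        · rw [Set.disjoint_left]
          rintro _ ⟨p, _, rfl⟩ ⟨q, _, hq⟩
          simp at hq

theorem WSet_ncard (a b : ℕ) : (WSet a b).ncard = (a + b).choose a := WSet_ncard_aux _ a b rfl

theorem ncard_first (a b : ℕ) :
    {p : LatticePath | p ∈ WSet (a + 1) b ∧ FirstStep p true}.ncard = (a + b).choose a := by
  rw [← WSet_ncard, ← Set.ncard_image_of_injective (WSet a b) (List.cons_injective (a := true))]
  congr 1
  ext p
  rcases p with _ | ⟨c, p⟩
  · simp [WSet, FirstStep]
  · cases c <;> simp [WSet, FirstStep]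

theorem ncard_last (a b : ℕ) :
    {p : LatticePath | p ∈ WSet a (b + 1) ∧ LastStep p false}.ncard = (a + b).choose a := by
  rw [← WSet_ncard, ← Set.ncard_image_of_injective (WSet a b)
    (List.append_left_injective [false])]
  congr 1
  ext p
  rcases List.eq_nil_or_concat p with rfl | ⟨q, c, rfl⟩
  · simp [WSet, LastStep]
  · cases c <;> simp [WSet, LastStep]

theorem ncard_first_last (a b : ℕ) :
    {p : LatticePath | p ∈ WSet (a + 1) (b + 1) ∧ FirstStep p true ∧ LastStep p false}.ncard
      = (a + b).choose a := by
  rw [← ncard_last,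
    ← Set.ncard_image_of_injective {p : LatticePath | p ∈ WSet a (b + 1) ∧ LastStep p false}
      (List.cons_injective (a := true))]
  congr 1
  ext p
  rcases p with _ | ⟨c, p⟩
  · simp [WSet, FirstStep]
  · cases c
    · simp [WSet, FirstStep]
    · rcases p with _ | ⟨d, p⟩ <;> simp [WSet, FirstStep, LastStep]

theorem InL_iff (α β k : ℕ) (p : LatticePath) : InL α β k p ↔ p ∈ WSet (α * k) (β * k) := Iff.rfl

/-- No right bounces. -/
def NRB (α β : ℕ) (p : LatticePath) : Prop := ∀ i, ¬ IsRightBounce α β p i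

theorem bounce_append_lt (α β : ℕ) (p q : LatticePath) (m : ℕ) (h : m + 1 < p.length) :
    IsRightBounce α β (p ++ q) m ↔ IsRightBounce α β p m := by
  unfold IsRightBounce
  rw [List.getElem?_append_left (by omega), List.getElem?_append_left h,
    List.take_append_of_le_length (by omega)]

theorem bounce_append_at (α β i : ℕ) (p q : LatticePath) (hp : InL α β i p)
    (hl : LastStep p false) (hq : FirstStep q true) :
    IsRightBounce α β (p ++ q) (p.length - 1) := by
  rcases List.eq_nil_or_concat p with rfl | ⟨p, c, rfl⟩
  · simp [LastStep] at hl
  rcases q with _ | ⟨d, q⟩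
  · simp [FirstStep] at hq
  obtain ⟨h1, h2⟩ := hp
  simp only [LastStep, FirstStep, List.concat_eq_append, List.getLast?_append, List.head?_cons,
    List.getLast?_singleton, Option.some_or, Option.some.injEq] at hl hq
  subst hl hq
  rw [List.concat_eq_append] at *
  refine ⟨by simp, by simp, ?_⟩
  have : (p ++ [false] ++ true :: q).take ((p ++ [false]).length - 1 + 1) = p ++ [false] := by
    rw [show (p ++ [false]).length - 1 + 1 = (p ++ [false]).length by simp, List.take_left']
    rfl
  rw [this, h1, h2]
  ring

theorem length_le_aux (α β i i' : ℕ) (p q p' q' : LatticePath) (hp : InL α β i p)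
    (hl : LastStep p false) (hq : FirstStep q true)
    (hr : NRB α β p') (h : p ++ q = p' ++ q') : p'.length ≤ p.length := by
  by_contra hlt
  have hb := bounce_append_at α β i p q hp hl hq
  rw [h, bounce_append_lt] at hb
  · exact hr _ hb
  · have : p ≠ [] := by rintro rfl; simp [LastStep] at hl
    have := List.length_pos_iff.2 this
    omega

theorem NRB_of_min (α β : ℕ) (p : LatticePath) (m : ℕ)
    (hmin : ∀ i < m, ¬ IsRightBounce α β p i) : NRB α β (p.take (m + 1)) := by
  intro i hi
  have h2 : i + 1 < (p.take (m + 1)).length := by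
    by_contra hc
    have := hi.2.1
    rw [List.getElem?_eq_none (by omega)] at this
    simp at this
  have := (bounce_append_lt α β (p.take (m + 1)) (p.drop (m + 1)) i h2).2 hi
  rw [List.take_append_drop] at this
  refine hmin i ?_ this
  rw [List.length_take] at h2
  omega

theorem on_line (α β x y : ℕ) (hα : 0 < α) (hcop : Nat.Coprime α β) (h : α * y = β * x) :
    ∃ i, x = α * i ∧ y = β * i := by
  have hd : α ∣ x := hcop.dvd_of_dvd_mul_left ⟨y, h.symm⟩
  obtain ⟨i, rfl⟩ := hd
  refine ⟨i, rfl, ?_⟩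
  apply Nat.eq_of_mul_eq_mul_left hα
  rw [h]; ring

theorem decomp_card (α β : ℕ) (hα : 0 < α) (hcop : Nat.Coprime α β)
    (Q : LatticePath → Prop) (hQ : ∀ p q, q ≠ [] → (Q (p ++ q) ↔ Q q)) (k : ℕ) :
    {p | InL α β k p ∧ Q p}.ncard = {p | InL α β k p ∧ NRB α β p ∧ Q p}.ncard +
      ∑ ij ∈ Finset.HasAntidiagonal.antidiagonal k,
        {p | InL α β ij.1 p ∧ NRB α β p ∧ LastStep p false}.ncard *
        {p | InL α β ij.2 p ∧ FirstStep p true ∧ Q p}.ncard := by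
  classical
  have hfin : ∀ (k : ℕ) (R : LatticePath → Prop), {p | InL α β k p ∧ R p}.Finite := fun k R =>
    (WSet_finite (α * k) (β * k)).subset fun p hp => hp.1
  have hsplit : {p | InL α β k p ∧ Q p} = {p | InL α β k p ∧ NRB α β p ∧ Q p} ∪
      {p | InL α β k p ∧ ¬ NRB α β p ∧ Q p} := by
    ext p
    simp only [Set.mem_ofPred_eq, Set.mem_union]
    tauto
  rw [hsplit, Set.ncard_union_eq ?_ (hfin _ _) (hfin _ _)]
  swap
  · rw [Set.disjoint_left]
    rintro p ⟨_, h, _⟩ ⟨_, h', _⟩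
    exact h' h
  congr 1
  have hA : ∀ i, {p | InL α β i p ∧ NRB α β p ∧ LastStep p false}.ncard =
      (hfin i (fun p => NRB α β p ∧ LastStep p false)).toFinset.card := fun i =>
    Set.ncard_eq_toFinset_card _ _
  have hB : ∀ i, {p | InL α β i p ∧ FirstStep p true ∧ Q p}.ncard =
      (hfin i (fun p => FirstStep p true ∧ Q p)).toFinset.card := fun i =>
    Set.ncard_eq_toFinset_card _ _
  rw [Set.ncard_eq_toFinset_card _ (hfin k (fun p => ¬ NRB α β p ∧ Q p))]
  simp only [hA, hB, ← Finset.card_product]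
  rw [← Finset.card_sigma]
  symm
  refine Finset.card_bij (fun x _ => x.2.1 ++ x.2.2) ?_ ?_ ?_
  · rintro ⟨⟨i, j⟩, p, q⟩ h
    simp only [Finset.mem_sigma, Finset.HasAntidiagonal.mem_antidiagonal, Finset.mem_product,
      Set.Finite.mem_toFinset, Set.mem_ofPred_eq] at h ⊢
    obtain ⟨rfl, ⟨hp, hr, hl⟩, hq, hf, hqq⟩ := h
    refine ⟨?_, fun hn => hn _ (bounce_append_at α β i p q hp hl hf), (hQ _ _ ?_).2 hqq⟩
    · unfold InL at *
      simp only [List.count_append, hp, hq]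
      constructor <;> ring
    · rintro rfl
      simp [FirstStep] at hf
  · rintro ⟨⟨i, j⟩, p, q⟩ h ⟨⟨i', j'⟩, p', q'⟩ h' heq
    simp only [Finset.mem_sigma, Finset.HasAntidiagonal.mem_antidiagonal, Finset.mem_product,
      Set.Finite.mem_toFinset, Set.mem_ofPred_eq] at h h' heq
    obtain ⟨hk, ⟨hp, hr, hl⟩, hq, hf, hqq⟩ := h
    obtain ⟨hk', ⟨hp', hr', hl'⟩, hq', hf', hqq'⟩ := h'
    have h1 := length_le_aux α β i i' p q p' q' hp hl hf hr' heq
    have h2 := length_le_aux α β i' i p' q' p q hp' hl' hf' hr heq.symm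
    obtain ⟨rfl, rfl⟩ := List.append_inj heq (le_antisymm h2 h1)
    have : α * i = α * i' := hp.1.symm.trans hp'.1
    have hi := Nat.eq_of_mul_eq_mul_left hα this
    subst hi
    have : j = j' := by omega
    subst this
    rfl
  · intro p hp
    simp only [Set.Finite.mem_toFinset, Set.mem_ofPred_eq] at hp
    obtain ⟨hp, hn, hqp⟩ := hp
    unfold NRB at hn
    push Not at hn
    have hm := Nat.find_spec hn
    have hmin := fun i (hi : i < Nat.find hn) => Nat.find_min hn hi
    generalize Nat.find hn = m at hm hmin
    have hlen : m + 1 < p.length := by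
      by_contra hc
      have := hm.2.1
      rw [List.getElem?_eq_none (by omega)] at this
      simp at this
    obtain ⟨i, hx, hy⟩ := on_line α β _ _ hα hcop hm.2.2
    have hc1 : (p.take (m + 1)).count true + (p.drop (m + 1)).count true = α * k := by
      rw [← List.count_append, List.take_append_drop, hp.1]
    have hc2 : (p.take (m + 1)).count false + (p.drop (m + 1)).count false = β * k := by
      rw [← List.count_append, List.take_append_drop, hp.2]
    rw [hx] at hc1
    rw [hy] at hc2
    have hik : i ≤ k := by
      apply Nat.le_of_mul_le_mul_left _ hα
      omega
    obtain ⟨j, rfl⟩ := Nat.exists_eq_add_of_le hik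
    rw [mul_add] at hc1 hc2
    refine ⟨⟨(i, j), p.take (m + 1), p.drop (m + 1)⟩, ?_, List.take_append_drop _ _⟩
    simp only [Finset.mem_sigma, Finset.HasAntidiagonal.mem_antidiagonal, Finset.mem_product,
      Set.Finite.mem_toFinset, Set.mem_ofPred_eq]
    refine ⟨trivial, ⟨⟨hx, hy⟩, NRB_of_min α β p m hmin, ?_⟩, ⟨by omega, by omega⟩, ?_, ?_⟩
    · unfold LastStep
      rw [List.getLast?_take]
      simp [hm.1]
    · unfold FirstStep
      rw [List.head?_drop, hm.2.1]
    · rw [← hQ (p.take (m + 1)), List.take_append_drop]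
      · exact hqp
      · intro h0
        rw [List.drop_eq_nil_iff] at h0
        omega

theorem decomp_gf (α β : ℕ) (hα : 0 < α) (hcop : Nat.Coprime α β)
    (Q : LatticePath → Prop) (hQ : ∀ p q, q ≠ [] → (Q (p ++ q) ↔ Q q)) :
    gfOf (fun k => {p | InL α β k p ∧ Q p}) =
      gfOf (fun k => {p | InL α β k p ∧ NRB α β p ∧ Q p}) +
      gfOf (fun k => {p | InL α β k p ∧ NRB α β p ∧ LastStep p false}) *
      gfOf (fun k => {p | InL α β k p ∧ FirstStep p true ∧ Q p}) := by
  have nil0 : ∀ p, InL α β 0 p → p = [] := by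
    rintro p ⟨h1, h2⟩
    have := List.count_true_add_count_false p
    apply List.length_eq_zero_iff.1
    omega
  have hA : {p | InL α β 0 p ∧ NRB α β p ∧ LastStep p false} = ∅ := by
    ext p
    simp only [Set.mem_ofPred_eq, Set.mem_empty_iff_false, iff_false]
    rintro ⟨h, _, h2⟩
    rw [nil0 p h] at h2
    simp [LastStep] at h2
  have hB : {p | InL α β 0 p ∧ FirstStep p true ∧ Q p} = ∅ := by
    ext p
    simp only [Set.mem_ofPred_eq, Set.mem_empty_iff_false, iff_false]
    rintro ⟨h, h2, _⟩
    rw [nil0 p h] at h2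
    simp [FirstStep] at h2
  have eA : ∀ k, PowerSeries.coeff k
      (gfOf (fun k => {p | InL α β k p ∧ NRB α β p ∧ LastStep p false})) =
      ({p | InL α β k p ∧ NRB α β p ∧ LastStep p false}.ncard : ℚ) := by
    intro k
    rw [gfOf, PowerSeries.coeff_mk]
    split_ifs with h
    · subst h; rw [hA]; simp
    · rfl
  have eB : ∀ k, PowerSeries.coeff k
      (gfOf (fun k => {p | InL α β k p ∧ FirstStep p true ∧ Q p})) =
      ({p | InL α β k p ∧ FirstStep p true ∧ Q p}.ncard : ℚ) := by
    intro k
    rw [gfOf, PowerSeries.coeff_mk]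
    split_ifs with h
    · subst h; rw [hB]; simp
    · rfl
  ext k
  rw [map_add, PowerSeries.coeff_mul]
  simp only [eA, eB]
  rw [gfOf, gfOf, PowerSeries.coeff_mk, PowerSeries.coeff_mk]
  by_cases hk : k = 0
  · subst hk
    simp [hB]
  · rw [if_neg hk, if_neg hk, decomp_card α β hα hcop Q hQ k]
    push_cast
    rfl

theorem left_of_reverse (α β k : ℕ) (p : LatticePath) (hp : InL α β k p) (i : ℕ)
    (h : IsLeftBounce α β p i) : ∃ j, IsRightBounce α β p.reverse j := by
  obtain ⟨h1, h2, h3⟩ := h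
  have hlen : i + 1 < p.length := by
    by_contra hc
    rw [List.getElem?_eq_none (by omega)] at h2
    simp at h2
  have hc : ∀ b, (p.take (i + 1)).count b + (p.drop (i + 1)).count b = p.count b := by
    intro b
    rw [← List.count_append, List.take_append_drop]
  refine ⟨p.length - (i + 1) - 1, ?_, ?_, ?_⟩
  · rw [List.getElem?_reverse (by omega), ← h2]
    congr 1; omega
  · rw [List.getElem?_reverse (by omega), ← h1]
    congr 1; omega
  · rw [List.take_reverse, List.count_reverse, List.count_reverse,
      show p.length - (p.length - (i + 1) - 1 + 1) = i + 1 by omega]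
    have ht := hc true
    have hf := hc false
    rw [hp.1] at ht
    rw [hp.2] at hf
    have e1 : α * (β * k) = β * (α * k) := by ring
    rw [← ht, ← hf, mul_add, mul_add] at e1
    omega

theorem right_of_reverse (α β k : ℕ) (p : LatticePath) (hp : InL α β k p) (i : ℕ)
    (h : IsRightBounce α β p i) : ∃ j, IsLeftBounce α β p.reverse j := by
  obtain ⟨h1, h2, h3⟩ := h
  have hlen : i + 1 < p.length := by
    by_contra hc
    rw [List.getElem?_eq_none (by omega)] at h2
    simp at h2
  have hc : ∀ b, (p.take (i + 1)).count b + (p.drop (i + 1)).count b = p.count b := by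
    intro b
    rw [← List.count_append, List.take_append_drop]
  refine ⟨p.length - (i + 1) - 1, ?_, ?_, ?_⟩
  · rw [List.getElem?_reverse (by omega), ← h2]
    congr 1; omega
  · rw [List.getElem?_reverse (by omega), ← h1]
    congr 1; omega
  · rw [List.take_reverse, List.count_reverse, List.count_reverse,
      show p.length - (p.length - (i + 1) - 1 + 1) = i + 1 by omega]
    have ht := hc true
    have hf := hc false
    rw [hp.1] at ht
    rw [hp.2] at hf
    have e1 : α * (β * k) = β * (α * k) := by ring
    rw [← ht, ← hf, mul_add, mul_add] at e1
    omega

theorem nrb_eq_nlb (α β : ℕ) : nrbAll α β = nlbAll α β := by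
  unfold nrbAll nlbAll
  have hInL : ∀ k p, InL α β k p → InL α β k p.reverse := by
    rintro k p ⟨h1, h2⟩
    exact ⟨by rw [List.count_reverse, h1], by rw [List.count_reverse, h2]⟩
  have key : ∀ k, {p | InL α β k p ∧ ∀ i, ¬ IsLeftBounce α β p i} =
      List.reverse '' {p | InL α β k p ∧ ∀ i, ¬ IsRightBounce α β p i} := by
    intro k
    ext p
    constructor
    · rintro ⟨hp, h⟩
      refine ⟨p.reverse, ⟨hInL k p hp, fun i hi => ?_⟩, List.reverse_reverse p⟩
      obtain ⟨j, hj⟩ := right_of_reverse α β k _ (hInL k p hp) i hi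
      rw [List.reverse_reverse] at hj
      exact h j hj
    · rintro ⟨q, ⟨hq, h⟩, rfl⟩
      refine ⟨hInL k q hq, fun i hi => ?_⟩
      obtain ⟨j, hj⟩ := left_of_reverse α β k _ (hInL k q hq) i hi
      rw [List.reverse_reverse] at hj
      exact h j hj
  unfold gfOf
  ext k
  rw [PowerSeries.coeff_mk, PowerSeries.coeff_mk]
  beta_reduce
  rw [key, Set.ncard_image_of_injective _ List.reverse_injective]

theorem series_facts (α β : ℕ) (hα : 0 < α) (hβ : 0 < β) :
    gfOf (fun k => {p | InL α β k p ∧ True}) = gSer α β ∧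
    gSer α β = geeSer α β + 2 * genSer α β + gnnSer α β ∧
    gfOf (fun k => {p | InL α β k p ∧ LastStep p false}) = genSer α β + gnnSer α β ∧
    gfOf (fun k => {p | InL α β k p ∧ FirstStep p true ∧ True}) = genSer α β + geeSer α β ∧
    gfOf (fun k => {p | InL α β k p ∧ FirstStep p true ∧ LastStep p false}) = genSer α β := by
  have hpos : ∀ k, k ≠ 0 → ∃ a b, α * k = a + 1 ∧ β * k = b + 1 ∧
      (α + β) * k = a + b + 2 := by
    intro k hk
    have h1 : 0 < α * k := Nat.mul_pos hα (Nat.pos_of_ne_zero hk)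
    have h2 : 0 < β * k := Nat.mul_pos hβ (Nat.pos_of_ne_zero hk)
    refine ⟨α * k - 1, β * k - 1, by omega, by omega, ?_⟩
    rw [add_mul]; omega
  have pas : ∀ a b : ℕ, (a + b + 1).choose (a + 1) = (a + b).choose a + (a + b).choose (a + 1) :=
    fun a b => Nat.choose_succ_succ _ _
  have sym : ∀ a b : ℕ, (a + b).choose b = (a + b).choose a := fun a b => by
    rw [Nat.choose_symm_add]
  have first : ∀ a b : ℕ, (a + (b + 1)).choose a = (a + b).choose a + (a + b).choose (b + 1) := by
    intro a b
    rw [← sym a (b + 1), ← add_assoc, Nat.choose_succ_succ, sym]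
  refine ⟨?_, ?_, ?_, ?_, ?_⟩
  · ext k
    simp only [gfOf, gSer, PowerSeries.coeff_mk]
    split_ifs with hk
    · rfl
    · simp only [InL_iff, and_true, Set.ofPred_mem_eq, WSet_ncard, add_mul]
  · ext k
    rw [two_mul]
    simp only [map_add, gSer, geeSer, genSer, gnnSer, PowerSeries.coeff_mk]
    split_ifs with hk
    · simp
    · obtain ⟨a, b, h1, h2, h3⟩ := hpos k hk
      rw [h1, h2, h3]
      simp only [Nat.add_sub_cancel]
      have : (a + b + 2).choose (a + 1) = (a + b).choose (b + 1) +
          ((a + b).choose a + (a + b).choose a) + (a + b).choose (a + 1) := by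
        have h4 := first a b
        rw [show a + b + 2 = (a + b + 1) + 1 by ring, Nat.choose_succ_succ]
        rw [← add_assoc] at h4
        rw [h4, Nat.succ_eq_add_one, pas]
        ring
      exact_mod_cast this
  · ext k
    simp only [map_add, gfOf, genSer, gnnSer, PowerSeries.coeff_mk]
    split_ifs with hk
    · simp
    · obtain ⟨a, b, h1, h2, h3⟩ := hpos k hk
      simp only [InL_iff]
      rw [h1, h2, h3, ncard_last]
      simp only [Nat.add_sub_cancel]
      rw [show a + 1 + b = a + b + 1 by ring, pas]
      push_cast; rfl
  · ext k
    simp only [map_add, gfOf, genSer, geeSer, PowerSeries.coeff_mk]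
    split_ifs with hk
    · simp
    · obtain ⟨a, b, h1, h2, h3⟩ := hpos k hk
      simp only [InL_iff, and_true]
      rw [h1, h2, h3, ncard_first, first]
      simp only [Nat.add_sub_cancel]
      push_cast; rfl
  · ext k
    simp only [gfOf, genSer, PowerSeries.coeff_mk]
    split_ifs with hk
    · rfl
    · obtain ⟨a, b, h1, h2, h3⟩ := hpos k hk
      simp only [InL_iff]
      rw [h1, h2, h3, ncard_first_last]
      simp only [Nat.add_sub_cancel]

/-- The generating function of no-right-bounce paths equals that of
no-left-bounce paths, and `nrb·(1 + g_en) = g + g_en² − g_ee·g_nn`. -/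
theorem statement6 (α β : ℕ) (hα : 0 < α) (hβ : 0 < β) (hcop : Nat.Coprime α β) :
    nrbAll α β = nlbAll α β ∧
    nrbAll α β * (1 + genSer α β)
      = gSer α β + genSer α β ^ 2 - geeSer α β * gnnSer α β := by
  refine ⟨nrb_eq_nlb α β, ?_⟩
  obtain ⟨f1, f2, f3, f4, f5⟩ := series_facts α β hα hβ
  have d1 := decomp_gf α β hα hcop (fun _ => True) (fun _ _ _ => Iff.rfl)
  have d2 := decomp_gf α β hα hcop (fun p => LastStep p false) (fun p q hq => by
    unfold LastStep
    rw [List.getLast?_append_of_ne_nil _ hq])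
  have e : gfOf (fun k => {p | InL α β k p ∧ NRB α β p ∧ True}) = nrbAll α β := by
    simp only [and_true]
    rfl
  rw [f1, f4, e] at d1
  rw [f3, f5] at d2
  generalize gfOf (fun k => {p | InL α β k p ∧ NRB α β p ∧ LastStep p false}) = r at d1 d2
  linear_combination (-(1 + genSer α β)) * d1 + (genSer α β + geeSer α β) * d2 +
    genSer α β * f2
end

section
/- For α = β = 1, with c(x) the Catalan generating function: f_ee(x)·(1 + x·c(x)) = x·c(x)² − x·c(x), f_nn(x) = f_ee(x), f_en(x)·(1 + x·c(x)) = x·c(x)², and f(x) = 2·(c(x) − 1). -/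
/-- Automaton accepting completions of bounce-free paths: at distance `h` from the diagonal,
on the side `s`; at `h = 0` the last step was `!s`. -/
def acc (b : Bool) : ℕ → Bool → List Bool → Prop
  | 0, s, [] => b = !s
  | _ + 1, _, [] => False
  | 0, s, x :: l => x = !s ∧ acc b 1 x l
  | h + 1, s, x :: l => if x = s then acc b (h + 2) s l else acc b h s l

/-- Number of accepted completions of given length. -/
def cnt (b : Bool) : ℕ → ℕ → Bool → ℕ
  | 0, 0, s => if b = !s then 1 else 0
  | 0, _ + 1, _ => 0
  | n + 1, 0, s => cnt b n 1 (!s)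
  | n + 1, h + 1, s => cnt b n (h + 2) s + cnt b n h s

theorem ncard_cons (n : ℕ) (P : List Bool → Prop) :
    {l : List Bool | l.length = n + 1 ∧ P l}.ncard =
      {l : List Bool | l.length = n ∧ P (true :: l)}.ncard +
      {l : List Bool | l.length = n ∧ P (false :: l)}.ncard := by
  have hf : ∀ Q : List Bool → Prop, {l : List Bool | l.length = n ∧ Q l}.Finite := fun Q =>
    (List.finite_length_eq Bool n).subset (fun l hl => hl.1)
  rw [← Set.ncard_image_of_injective {l : List Bool | l.length = n ∧ P (true :: l)}
      (List.cons_injective (a := true)),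
    ← Set.ncard_image_of_injective {l : List Bool | l.length = n ∧ P (false :: l)}
      (List.cons_injective (a := false)), ← Set.ncard_union_eq _ ((hf _).image _) ((hf _).image _)]
  · congr 1
    ext l
    rcases l with _ | ⟨x, l⟩
    · simp
    · cases x <;> simp
  · rw [Set.disjoint_left]
    rintro _ ⟨l, _, rfl⟩ ⟨l', _, h⟩
    simp at h

theorem ncard_acc (b : Bool) (n h : ℕ) (s : Bool) :
    {l : List Bool | l.length = n ∧ acc b h s l}.ncard = cnt b n h s := by
  induction n generalizing h s with
  | zero =>
    by_cases hacc : acc b h s []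
    · have : {l : List Bool | l.length = 0 ∧ acc b h s l} = {[]} := by
        ext l
        rcases l with _ | ⟨x, l⟩ <;> simp_all
      rw [this, Set.ncard_singleton]
      cases h <;> simp_all [acc, cnt]
    · have : {l : List Bool | l.length = 0 ∧ acc b h s l} = ∅ := by
        ext l
        rcases l with _ | ⟨x, l⟩ <;> simp_all
      rw [this, Set.ncard_empty]
      cases h <;> simp_all [acc, cnt]
  | succ n ih =>
    rw [ncard_cons]
    cases h <;> cases s <;> simp [acc, cnt, ih]
    omega

theorem cnt_lt (b : Bool) (n h : ℕ) (s : Bool) (hn : n < h) : cnt b n h s = 0 := by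
  induction n generalizing h s with
  | zero => cases h <;> simp_all [cnt]
  | succ n ih =>
    cases h with
    | zero => omega
    | succ h => simp [cnt, ih (h + 2) s (by omega), ih h s (by omega)]

open PowerSeries in
noncomputable def G (b s : Bool) (h : ℕ) : PowerSeries ℚ :=
  PowerSeries.mk fun k => (cnt b (2 * k + h) h s : ℚ)

theorem G_zero (b s : Bool) : G b s 0 = (if b = !s then 1 else 0) + PowerSeries.X * G b (!s) 1 := by
  ext k
  cases k with
  | zero => simp only [G, PowerSeries.coeff_mk]; split_ifs <;> simp_all [cnt]
  | succ k =>
    rw [map_add, PowerSeries.coeff_succ_X_mul]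
    have : 2 * (k + 1) + 0 = (2 * k + 1) + 1 := by ring
    simp only [G, PowerSeries.coeff_mk, this, cnt]
    split_ifs <;> simp [PowerSeries.coeff_one]

theorem G_succ (b s : Bool) (h : ℕ) :
    G b s (h + 1) = PowerSeries.X * G b s (h + 2) + G b s h := by
  ext k
  cases k with
  | zero => simp [G, cnt, cnt_lt b h (h + 2) s (by omega)]
  | succ k =>
    rw [map_add, PowerSeries.coeff_succ_X_mul]
    have : 2 * (k + 1) + (h + 1) = (2 * k + (h + 2)) + 1 := by ring
    have h2 : 2 * (k + 1) + h = (2 * k + (h + 2)) := by ring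
    simp only [G, PowerSeries.coeff_mk]
    rw [this, h2, cnt]
    push_cast; rfl

theorem fc_eq : fussCatalan 1 = 1 + PowerSeries.X * fussCatalan 1 ^ 2 := by
  have h1 : fussCatalan 1 = PowerSeries.map (Nat.castRingHom ℚ) PowerSeries.catalanSeries := by
    ext k
    simp only [fussCatalan, PowerSeries.coeff_mk, PowerSeries.coeff_map,
      PowerSeries.catalanSeries_coeff]
    have := succ_mul_catalan_eq_centralBinom k
    have h3 : ((k : ℚ) + 1) * catalan k = (2 * k).choose k := by
      exact_mod_cast this
    have h4 : (k : ℚ) + 1 ≠ 0 := by positivity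
    simp only [one_mul, eq_natCast]
    rw [show (1 + 1) * k = 2 * k by ring, ← h3]
    push_cast
    field_simp
  have h2 := congrArg (PowerSeries.map (Nat.castRingHom ℚ))
    PowerSeries.catalanSeries_sq_mul_X_add_one
  rw [map_add, map_mul, map_pow, ← h1] at h2
  simp only [map_one, PowerSeries.map_X] at h2
  linear_combination -h2

/-- uniqueness of the solution of the recursion -/
theorem G_pow (b s : Bool) (h : ℕ) : G b s h = fussCatalan 1 ^ h * G b s 0 := by
  have key : ∀ n k h, k + (k + h) = n → PowerSeries.coeff k (G b s h) =
      PowerSeries.coeff k (fussCatalan 1 ^ h * G b s 0) := by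
    intro n
    induction n with
    | zero =>
      intro k h hk
      obtain rfl : h = 0 := by omega
      simp
    | succ n ih =>
      intro k h hk
      cases h with
      | zero => simp
      | succ h =>
        have e : fussCatalan 1 ^ (h + 1) * G b s 0 =
            PowerSeries.X * (fussCatalan 1 ^ (h + 2) * G b s 0) + fussCatalan 1 ^ h * G b s 0 := by
          linear_combination (fussCatalan 1 ^ h * G b s 0) * fc_eq
        rw [e, G_succ, map_add, map_add, ih k h (by omega)]
        congr 1
        cases k with
        | zero => simp
        | succ k =>
          rw [PowerSeries.coeff_succ_X_mul, PowerSeries.coeff_succ_X_mul]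
          exact ih k (h + 2) (by omega)
  ext k
  exact key _ k h rfl

/-- Bounce at index `i`. -/
def Bn (p : List Bool) (i : ℕ) : Prop :=
  ∃ y, p[i]? = some y ∧ p[i + 1]? = some (!y) ∧
    (p.take (i + 1)).count false = (p.take (i + 1)).count true

theorem bounceFree_iff (p : List Bool) : BounceFree 1 1 p ↔ ∀ i, ¬ Bn p i := by
  simp only [BounceFree, IsLeftBounce, IsRightBounce, Bn, one_mul, ← forall_and]
  refine forall_congr' fun i => ?_
  simp [Bool.exists_bool]
  tauto

theorem acc_iff (b : Bool) (l : List Bool) : ∀ (q : List Bool) (y s : Bool) (h : ℕ),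
    (q ++ [y]).count s = (q ++ [y]).count (!s) + h → (h = 0 → y = !s) →
    (acc b h s l ↔ (q ++ [y] ++ l).count true = (q ++ [y] ++ l).count false ∧
      (q ++ [y] ++ l).getLast? = some b ∧ ∀ i, q.length ≤ i → ¬ Bn (q ++ [y] ++ l) i) := by
  induction l with
  | nil =>
    intro q y s h hc hy
    have hnb : ∀ i, q.length ≤ i → ¬ Bn (q ++ [y] ++ []) i := by
      rintro i hi ⟨z, h1, h2, -⟩
      rw [List.getElem?_eq_none (by simp; omega)] at h2
      simp at h2
    rw [← and_assoc, and_iff_left hnb]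
    cases h with
    | zero =>
      have := hy rfl
      subst this
      cases s <;> simp_all [acc] <;> tauto
    | succ h =>
      simp only [acc, false_iff, List.append_nil]
      rintro ⟨h1, -⟩
      cases s <;> simp only [Bool.not_true, Bool.not_false] at hc <;> omega
  | cons x l ih =>
    intro q y s h hc hy
    have e : q ++ [y] ++ x :: l = (q ++ [y]) ++ [x] ++ l := by simp
    have hB : Bn (q ++ [y] ++ x :: l) q.length ↔ x = !y ∧ h = 0 := by
      have h1 : (q ++ [y] ++ x :: l)[q.length]? = some y := by simp
      have h2 : (q ++ [y] ++ x :: l)[q.length + 1]? = some x := by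
        simp [List.getElem?_append_right]
      have h3 : (q ++ [y] ++ x :: l).take (q.length + 1) = q ++ [y] := by
        rw [List.take_left' (by simp)]
      unfold Bn
      rw [h1, h2, h3]
      constructor
      · rintro ⟨z, h4, h5, h6⟩
        simp only [Option.some.injEq] at h4 h5
        subst h4
        refine ⟨h5, ?_⟩
        cases s <;> simp only [Bool.not_true, Bool.not_false] at hc <;> omega
      · rintro ⟨h4, h5⟩
        refine ⟨y, rfl, by rw [h4], ?_⟩
        cases s <;> simp only [Bool.not_true, Bool.not_false] at hc <;> omega
    have hsplit : (∀ i, q.length ≤ i → ¬ Bn (q ++ [y] ++ x :: l) i) ↔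
        ¬ (x = !y ∧ h = 0) ∧ ∀ i, (q ++ [y]).length ≤ i → ¬ Bn ((q ++ [y]) ++ [x] ++ l) i := by
      rw [← hB, ← e]
      constructor
      · intro H
        exact ⟨H _ le_rfl, fun i hi => H i (by simp at hi; omega)⟩
      · rintro ⟨H1, H2⟩ i hi
        rcases hi.eq_or_lt with rfl | hi
        · exact H1
        · exact H2 i (by simp; omega)
    rw [hsplit, e]
    cases h with
    | zero =>
      have hy' := hy rfl
      subst hy'
      simp only [acc, Bool.not_not, and_true]
      by_cases hx : x = !s
      · subst hx
        rw [ih (q ++ [!s]) (!s) (!s) 1 (by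
          rw [List.count_append, List.count_append (a := !!s)]
          cases s <;> simp_all) (by simp)]
        simp
      · have : x = s := by cases x <;> cases s <;> simp_all
        simp [this]
    | succ h =>
      simp only [acc, Nat.succ_ne_zero, and_false, not_false_eq_true, true_and]
      split_ifs with hx
      · subst hx
        exact ih (q ++ [y]) x x (h + 2) (by
          rw [List.count_append, List.count_append (a := !x), hc]
          cases x <;> simp <;> omega) (by simp)
      · have hx : x = !s := by cases x <;> cases s <;> simp_all
        subst hx
        exact ih (q ++ [y]) (!s) s h (by
          rw [List.count_append, List.count_append (a := !s), hc]
          cases s <;> simp <;> omega) (by simp)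

theorem count_add (l : List Bool) : l.count true + l.count false = l.length := by
  have := List.count_not_add_count l false
  simpa using this

theorem path_iff (b s : Bool) (k : ℕ) (l : List Bool) :
    (InL 1 1 k (s :: l) ∧ BounceFree 1 1 (s :: l) ∧ LastStep (s :: l) b) ↔
      (l.length + 1 = 2 * k ∧ acc b 1 s l) := by
  have h := acc_iff b l [] s s 1 (by simp) (by simp)
  have h2 := count_add (s :: l)
  simp only [List.nil_append, List.singleton_append, List.length_nil, Nat.zero_le,
    forall_const] at h
  rw [h, bounceFree_iff, InL, LastStep]
  simp only [List.length_cons] at h2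
  constructor
  · rintro ⟨⟨h3, h4⟩, h5, h6⟩
    exact ⟨by omega, by omega, h6, h5⟩
  · rintro ⟨h3, h4, h5, h6⟩
    exact ⟨⟨by omega, by omega⟩, h6, h5⟩

/-- The bounce-free paths with prescribed first and last step. -/
def SS (s b : Bool) (k : ℕ) : Set LatticePath :=
  {p | InL 1 1 k p ∧ BounceFree 1 1 p ∧ FirstStep p s ∧ LastStep p b}

theorem SS_eq (s b : Bool) (k : ℕ) :
    SS s b (k + 1) = (List.cons s) '' {l | l.length = 2 * k + 1 ∧ acc b 1 s l} := by
  ext p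
  rcases p with _ | ⟨x, l⟩
  · simp [SS, FirstStep]
  · have := path_iff b x (k + 1) l
    simp only [SS, FirstStep, Set.mem_setOf_eq, List.head?_cons, Option.some.injEq, Set.mem_image,
      List.cons.injEq]
    constructor
    · rintro ⟨h1, h2, rfl, h4⟩
      obtain ⟨h5, h6⟩ := this.1 ⟨h1, h2, h4⟩
      exact ⟨l, ⟨by omega, h6⟩, rfl, rfl⟩
    · rintro ⟨l', ⟨h1, h2⟩, rfl, rfl⟩
      obtain ⟨h5, h6, h7⟩ := this.2 ⟨by omega, h2⟩
      exact ⟨h5, h6, rfl, h7⟩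

theorem SS_finite (s b : Bool) (k : ℕ) : (SS s b k).Finite := by
  refine (List.finite_length_eq Bool (2 * k)).subset ?_
  rintro l ⟨⟨h1, h2⟩, -⟩
  have := count_add l
  simp only [Set.mem_setOf_eq]
  omega

theorem SS_ncard (s b : Bool) (k : ℕ) : (SS s b (k + 1)).ncard = cnt b (2 * k + 1) 1 s := by
  rw [SS_eq, Set.ncard_image_of_injective _ List.cons_injective, ncard_acc]

theorem gf_SS (s b : Bool) : gfOf (SS s b) = PowerSeries.X * fussCatalan 1 * G b s 0 := by
  have : gfOf (SS s b) = PowerSeries.X * G b s 1 := by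
    ext k
    cases k with
    | zero => simp [gfOf]
    | succ k => rw [PowerSeries.coeff_succ_X_mul]; simp [gfOf, G, SS_ncard]
  rw [this, G_pow b s 1]
  ring

theorem fSer_eq : fSer 1 1 = gfOf (SS true true) + gfOf (SS true false) + gfOf (SS false true)
    + gfOf (SS false false) := by
  ext k
  simp only [fSer, gfOf, map_add, PowerSeries.coeff_mk]
  split_ifs with hk
  · simp
  have hU : {p | InL 1 1 k p ∧ BounceFree 1 1 p} =
      ((SS true true k ∪ SS true false k) ∪ SS false true k) ∪ SS false false k := by
    ext p
    rcases List.eq_nil_or_concat p with rfl | ⟨q, y, hq⟩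
    · simp [SS, FirstStep, InL]; omega
    · have h2 : p.getLast? = some y := by simp [hq]
      rcases p with _ | ⟨x, l⟩
      · simp at h2
      · simp only [SS, FirstStep, LastStep, h2, Set.mem_union, Set.mem_setOf_eq]
        cases x <;> cases y <;> simp
  have hd : ∀ s b s' b', (s, b) ≠ (s', b') → Disjoint (SS s b k) (SS s' b' k) := by
    intro s b s' b' hne
    rw [Set.disjoint_left]
    rintro p ⟨-, -, h1, h2⟩ ⟨-, -, h3, h4⟩
    simp only [FirstStep, LastStep] at *
    rw [h1] at h3
    rw [h2] at h4
    simp_all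
  have hf := fun s b => SS_finite s b k
  rw [hU, Set.ncard_union_eq _ (((hf _ _).union (hf _ _)).union (hf _ _)) (hf _ _),
    Set.ncard_union_eq _ ((hf _ _).union (hf _ _)) (hf _ _),
    Set.ncard_union_eq (hd _ _ _ _ (by simp)) (hf _ _) (hf _ _)]
  · push_cast; rfl
  · rw [Set.disjoint_union_left]; exact ⟨hd _ _ _ _ (by simp), hd _ _ _ _ (by simp)⟩
  · rw [Set.disjoint_union_left, Set.disjoint_union_left]
    exact ⟨⟨hd _ _ _ _ (by simp), hd _ _ _ _ (by simp)⟩, hd _ _ _ _ (by simp)⟩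

/-- For `α = β = 1`, with `c(x) = c_1(x)` the Catalan generating
function: `f_ee·(1 + x·c) = x·c² − x·c`, `f_nn = f_ee`, `f_en·(1 + x·c) = x·c²`, and
`f = 2·(c − 1)`. -/
theorem statement15 :
    feeSer 1 1 * (1 + PowerSeries.X * fussCatalan 1)
      = PowerSeries.X * fussCatalan 1 ^ 2 - PowerSeries.X * fussCatalan 1 ∧
    fnnSer 1 1 = feeSer 1 1 ∧
    fenSer 1 1 * (1 + PowerSeries.X * fussCatalan 1)
      = PowerSeries.X * fussCatalan 1 ^ 2 ∧
    fSer 1 1 = 2 * (fussCatalan 1 - 1) := by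
  have hee : feeSer 1 1 = gfOf (SS true true) := rfl
  have hen : fenSer 1 1 = gfOf (SS true false) := rfl
  have hnn : fnnSer 1 1 = gfOf (SS false false) := rfl
  rw [fSer_eq, hee, hen, hnn]
  simp only [gf_SS]
  have hc := fc_eq
  have h1 := G_zero true true
  have h2 := G_zero true false
  have h3 := G_zero false true
  have h4 := G_zero false false
  rw [G_pow] at h1 h2 h3 h4
  rw [G_pow _ _ 1] at h1 h2 h3 h4
  simp only [pow_zero, pow_one, one_mul, Bool.not_true, Bool.not_false, if_true, reduceCtorEq,
    if_false, zero_add] at h1 h2 h3 h4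
  generalize fussCatalan 1 = c at *
  generalize G true true 0 = p at *
  generalize G true false 0 = q at *
  generalize G false true 0 = r at *
  generalize G false false 0 = t at *
  generalize (PowerSeries.X : PowerSeries ℚ) = x at *
  -- closed forms: q (1 + x c) = c etc.
  have k : c * (1 - x * c) = 1 := by linear_combination hc
  have hq : q * (1 + x * c) = c := by
    linear_combination (-(q * (1 + x * c))) * k + c * h2 + c * x * c * h1
  have hr : r * (1 + x * c) = c := by
    linear_combination (-(r * (1 + x * c))) * k + c * h3 + c * x * c * h4
  refine ⟨?_, ?_, ?_, ?_⟩
  · linear_combination x * c * (1 + x * c) * h1 + x * c * x * c * hq - x * c * hc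
  · linear_combination x * c * (h4 - h1) + (x * c) ^ 2 * (q * (h3 + x * c * h4) - r * (h2 + x * c * h1))
  · linear_combination x * c * hr
  · linear_combination x * c * h1 + x * c * h4 + x * c * hq + x * c * hr - 2 * hc
end
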